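/- Let V be a finite-dimensional real vector space, ω an alternating bilinear form on V, and W ⊆ V a linear subspace. Denote by i : W → V the inclusion and by i*ω the restriction of ω to W, so that W^{i*ω} = W^ω ∩ W. Then W is coisotropic (i.e. W^ω ⊆ W) if and only if dim W + dim W^{i*ω} ≥ dim V + dim V^ω. -/

import Mathlib

open FiniteDimensional Module

/-- The presymplectic complement `U^ω = {v ∈ V : ω(v,u) = 0 for all u ∈ U}`. -/
def presymplecticComplement {V : Type*} [AddCommGroup V] [Module ℝ V]
    (ω : V →ₗ[ℝ] V →ₗ[ℝ] ℝ) (U : Submodule ℝ V) : Submodule ℝ V where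
  carrier := {v | ∀ u ∈ U, ω v u = 0}
  add_mem' := by
    intro a b ha hb u hu
    simp [map_add, LinearMap.add_apply, ha u hu, hb u hu]
  zero_mem' := by intro u hu; simp
  smul_mem' := by
    intro c a ha u hu
    simp [map_smul, LinearMap.smul_apply, ha u hu]

theorem presymplecticComplement_eq_orthogonal {V : Type*} [AddCommGroup V] [Module ℝ V]
    {ω : LinearMap.BilinForm ℝ V} (hω : ω.IsRefl) (U : Submodule ℝ V) :
    presymplecticComplement ω U = ω.orthogonal U := by
  ext v
  exact forall₂_congr fun u _ => hω.eq_iff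

/-- `W` is coisotropic (`W^ω ⊆ W`) iff
`dim W + dim W^{i*ω} ≥ dim V + dim V^ω`, where `W^{i*ω} = W^ω ∩ W`. -/
theorem coisotropic_iff_dim_ineq
    {V : Type*} [AddCommGroup V] [Module ℝ V] [FiniteDimensional ℝ V]
    (ω : V →ₗ[ℝ] V →ₗ[ℝ] ℝ) (halt : ∀ v, ω v v = 0)
    (W : Submodule ℝ V) :
    presymplecticComplement ω W ≤ W ↔
      finrank ℝ V + finrank ℝ (presymplecticComplement ω (⊤ : Submodule ℝ V)) ≤
        finrank ℝ W + finrank ℝ (presymplecticComplement ω W ⊓ W : Submodule ℝ V) := by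
  have hrefl : LinearMap.BilinForm.IsRefl ω := LinearMap.BilinForm.IsAlt.isRefl halt
  rw [presymplecticComplement_eq_orthogonal hrefl, presymplecticComplement_eq_orthogonal hrefl]
  have hdim := LinearMap.BilinForm.finrank_add_finrank_orthogonal hrefl W
  constructor
  · intro h
    have hrad : LinearMap.BilinForm.orthogonal ω ⊤ ≤ W :=
      (LinearMap.BilinForm.orthogonal_le le_top).trans h
    rw [inf_eq_left.mpr h, hdim, inf_eq_right.mpr hrad]
  · intro h
    have hle := Submodule.finrank_mono
      (inf_le_right : W ⊓ LinearMap.BilinForm.orthogonal ω ⊤ ≤ _)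
    exact inf_eq_left.mp (Submodule.eq_of_le_of_finrank_le inf_le_left (by omega))
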